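/- arXiv:1107.4019 — 2 statements merged into one kernel-verified Lean document; each statement's English description precedes it below -/
import Mathlib

section
/- Let K be an algebraically closed field of characteristic zero, and let n ≥ 2 and μ ≥ n be integers. Let a_0, a_1, …, a_{n−1} ∈ K(x) be rational functions, at least one of which does not lie in K. Set M = 2·n²·(n+1)·C(3n−1, n) (where C denotes the binomial coefficient; this is the value of the paper's bound M(n) = 2n(n+1)(g + n·C(3n−1,n)) for genus g = 0). If there is a set B ⊆ K with at least M elements such that for every b ∈ B the rational function b^n + a_{n−1}·b^{n−1} + ⋯ + a_1·b + a_0 ∈ K(x) is nonzero and μ-powerful, then μ = n and there exists ν ∈ K(x) such that T^n + a_{n−1}·T^{n−1} + ⋯ + a_1·T + a_0 = (T + ν)^n in K(x)[T]. -/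
open Polynomial

/-- A nonzero rational function `f` is `μ`-powerful if every root of its numerator
has multiplicity at least `μ`, and moreover either `deg num ≥ deg denom` or the
zero at infinity (of order `deg denom - deg num`) has multiplicity at least `μ`. -/
def IsMuPowerful {K : Type*} [Field K] (μ : ℕ) (f : RatFunc K) : Prop :=
  (∀ a : K, f.num.eval a = 0 → μ ≤ f.num.rootMultiplicity a) ∧
  (f.denom.natDegree ≤ f.num.natDegree ∨ f.num.natDegree + μ ≤ f.denom.natDegree)

namespace Polynomial.Bivariate

variable {K : Type*} [Field K]

/-- The partial derivative of a bivariate polynomial with respect to the inner variable. -/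
noncomputable def innerDerivative (p : K[X][X]) : K[X][X] := swap (derivative (swap p))

/-- The degree of a bivariate polynomial in the inner variable. -/
noncomputable def innerDegree (p : K[X][X]) : ℕ := (swap p).natDegree

lemma swap_innerDerivative (p : K[X][X]) :
    swap (innerDerivative p) = derivative (swap p) := by
  simp [innerDerivative, swap_swap_apply]

lemma swap_ne_zero {p : K[X][X]} (hp : p ≠ 0) : swap p ≠ 0 :=
  (map_ne_zero_iff _ (swap (R := K)).injective).2 hp

lemma innerDerivative_mul (p q : K[X][X]) :
    innerDerivative (p * q) = innerDerivative p * q + p * innerDerivative q := by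
  simp [innerDerivative, swap_swap_apply]

lemma innerDerivative_pow_succ (p : K[X][X]) (e : ℕ) :
    innerDerivative (p ^ (e + 1)) = (e + 1 : ℕ) * p ^ e * innerDerivative p := by
  simp [innerDerivative, swap_swap_apply, derivative_pow]

lemma innerDegree_mul {p q : K[X][X]} (hp : p ≠ 0) (hq : q ≠ 0) :
    innerDegree (p * q) = innerDegree p + innerDegree q := by
  simp [innerDegree, natDegree_mul (swap_ne_zero hp) (swap_ne_zero hq)]

lemma innerDegree_innerDerivative_lt {p : K[X][X]} (h : innerDerivative p ≠ 0) :
    innerDegree (innerDerivative p) < innerDegree p := by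
  rw [innerDegree, innerDegree, swap_innerDerivative]
  refine natDegree_derivative_lt fun h0 => h ?_
  rw [innerDerivative, derivative_of_natDegree_zero h0, map_zero]

lemma innerDerivative_eq_zero_of_dvd {p : K[X][X]} (h : p ∣ innerDerivative p) :
    innerDerivative p = 0 := by
  by_contra h0
  obtain ⟨q, hq⟩ := h
  have hpq : p * q ≠ 0 := hq ▸ h0
  have := innerDegree_innerDerivative_lt h0
  rw [hq, innerDegree_mul (left_ne_zero_of_mul hpq) (right_ne_zero_of_mul hpq)] at this
  omega

lemma coeff_coeff_swap (p : K[X][X]) (i j : ℕ) :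
    ((swap p).coeff i).coeff j = (p.coeff j).coeff i := by
  induction p using Polynomial.induction_on' with
  | add p q hp hq => simp [hp, hq]
  | monomial n a =>
    induction a using Polynomial.induction_on' with
    | add p q hp hq => simp [hp, hq]
    | monomial m r =>
      rw [swap_monomial_monomial]
      simp only [coeff_monomial]
      split_ifs <;> simp_all [coeff_monomial]

lemma natDegree_coeff_le_innerDegree (p : K[X][X]) (j : ℕ) :
    (p.coeff j).natDegree ≤ innerDegree p := by
  refine natDegree_le_iff_coeff_eq_zero.2 fun i hi => ?_
  rw [← coeff_coeff_swap, coeff_eq_zero_of_natDegree_lt hi, coeff_zero]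

lemma natDegree_coeff_swap_le (p : K[X][X]) (j : ℕ) :
    ((swap p).coeff j).natDegree ≤ p.natDegree := by
  refine natDegree_le_iff_coeff_eq_zero.2 fun i hi => ?_
  rw [coeff_coeff_swap, coeff_eq_zero_of_natDegree_lt hi, coeff_zero]

lemma eval_C_eq_map_swap (p : K[X][X]) (b : K) :
    p.eval (C b) = (swap p).map (evalRingHom b) := by
  induction p using Polynomial.induction_on' with
  | add p q hp hq => simp [hp, hq]
  | monomial n a =>
    induction a using Polynomial.induction_on' with
    | add p q hp hq => simp_all
    | monomial m r =>
      rw [swap_monomial_monomial]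
      simp [← C_mul_X_pow_eq_monomial]
      ring

lemma eval_C_innerDerivative (p : K[X][X]) (b : K) :
    (innerDerivative p).eval (C b) = derivative (p.eval (C b)) := by
  rw [eval_C_eq_map_swap, eval_C_eq_map_swap, swap_innerDerivative, derivative_map]

lemma natDegree_innerDerivative_le (p : K[X][X]) :
    (innerDerivative p).natDegree ≤ p.natDegree := by
  refine natDegree_le_iff_coeff_eq_zero.2 fun i hi => ?_
  ext j
  rw [← coeff_coeff_swap, swap_innerDerivative, coeff_derivative]
  have : ((swap p).coeff (j + 1)).coeff i = 0 := by
    rw [coeff_coeff_swap, coeff_eq_zero_of_natDegree_lt hi, coeff_zero]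
  have h2 : ((j : K[X]) + 1) = C ((j : K) + 1) := by simp
  rw [h2, coeff_mul_C, this]; simp

lemma natDegree_coeff_eq_zero_of_innerDerivative_eq_zero [CharZero K] {p : K[X][X]}
    (h : innerDerivative p = 0) (j : ℕ) : (p.coeff j).natDegree = 0 := by
  have h1 : (swap p).natDegree = 0 := by
    rw [← derivative_eq_zero, ← swap_innerDerivative, h, map_zero]
  exact Nat.le_zero.1 ((natDegree_coeff_le_innerDegree p j).trans h1.le)

/-- An irreducible factor of `F` divides the denominator of the reduced logarithmic derivative of
`F`, unless it is constant in the inner variable. -/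
lemma dvd_or_innerDerivative_eq_zero [CharZero K] {F S G c P : K[X][X]} (hF : F ≠ 0)
    (hS : c * S = F) (hG : c * G = innerDerivative F)
    (hP : Irreducible P) (hPF : P ∣ F) : P ∣ S ∨ innerDerivative P = 0 := by
  by_contra! hcon
  obtain ⟨hPS, hP0⟩ := hcon
  obtain ⟨W, hFW, hW⟩ :=
    (FiniteMultiplicity.of_not_isUnit hP.not_isUnit hF).exists_eq_pow_mul_and_not_dvd
  generalize multiplicity P F = e at hFW
  rcases e with _ | e
  · exact hW (by simpa [hFW] using hPF)
  have hc : P ^ (e + 1) ∣ c := by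
    refine hP.prime.pow_dvd_of_dvd_mul_right _ hPS ?_
    rw [hS, hFW]; exact dvd_mul_right _ _
  have h1 : P ^ (e + 1) ∣ innerDerivative F := hG ▸ dvd_mul_of_dvd_left hc G
  rw [hFW, innerDerivative_mul, innerDerivative_pow_succ,
    dvd_add_left (dvd_mul_right _ _), pow_succ,
    show ((e + 1 : ℕ) : K[X][X]) * P ^ e * innerDerivative P * W =
      P ^ e * (((e + 1 : ℕ) : K[X][X]) * (innerDerivative P * W)) by ring,
    mul_dvd_mul_iff_left (pow_ne_zero _ hP.ne_zero)] at h1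
  have hu : IsUnit ((e + 1 : ℕ) : K[X][X]) := by
    have : ((e + 1 : ℕ) : K[X][X]) = C (C ((e + 1 : ℕ) : K)) := by simp
    rw [this]
    exact (isUnit_C.2 (isUnit_C.2 (IsUnit.mk0 _ (Nat.cast_ne_zero.2 e.succ_ne_zero))))
  rw [hu.dvd_mul_left] at h1
  rcases hP.prime.dvd_or_dvd h1 with h | h
  · exact hP0 (innerDerivative_eq_zero_of_dvd h)
  · exact hW h

end Polynomial.Bivariate

/-- A multiplicative map killing a nonzero element kills one of its irreducible factors. -/
lemma exists_irreducible_dvd_map_eq_zero {A L : Type*} [CommRing A] [IsDomain A]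
    [WfDvdMonoid A] [Field L] (φ : A →* L) {a : A} (ha : a ≠ 0) (h : φ a = 0) :
    ∃ p, Irreducible p ∧ p ∣ a ∧ φ p = 0 := by
  induction a using WfDvdMonoid.induction_on_irreducible with
  | zero => exact (ha rfl).elim
  | unit u hu => exact ((hu.map φ).ne_zero h).elim
  | mul a i ha0 hi ih =>
    rw [map_mul, mul_eq_zero] at h
    rcases h with h | h
    · exact ⟨i, hi, dvd_mul_right _ _, h⟩
    · obtain ⟨p, hp, hpa, hp0⟩ := ih ha0 h
      exact ⟨p, hp, dvd_mul_of_dvd_right hpa _, hp0⟩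

namespace Polynomial

/-- Relatively prime polynomials over a UFD stay coprime over its fraction field. -/
lemma isCoprime_map_algebraMap_of_isRelPrime {R k : Type*} [CommRing R] [IsDomain R]
    [UniqueFactorizationMonoid R] [Field k] [Algebra R k] [IsFractionRing R k] {p q : R[X]}
    (hp : p ≠ 0) (h : IsRelPrime p q) :
    IsCoprime (p.map (algebraMap R k)) (q.map (algebraMap R k)) := by
  obtain ⟨_⟩ : Nonempty (NormalizedGCDMonoid R) := inferInstance
  have hinj := IsFractionRing.injective R k
  refine isCoprime_of_irreducible_dvd
    (fun h0 => hp ((Polynomial.map_eq_zero_iff hinj).1 h0.1)) fun z hz hzp hzq => ?_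
  obtain ⟨b, hb, hbz⟩ := IsLocalization.integerNormalization_spec (nonZeroDivisors R) z
  set w := IsLocalization.integerNormalization (nonZeroDivisors R) z
  have hb0 : algebraMap R k b ≠ 0 := by
    simpa using nonZeroDivisors.ne_zero hb
  have hbz' : w.map (algebraMap R k) = C (algebraMap R k b) * z := by
    rw [hbz, ← smul_eq_C_mul, ← algebraMap_smul k]
  have hwz : ∀ r : R[X], z ∣ r.map (algebraMap R k) → w.primPart ∣ r := fun r hr => by
    refine w.isPrimitive_primPart.dvd_of_fraction_map_dvd_fraction_map (K := k) ?_
    refine (Polynomial.map_dvd _ w.primPart_dvd).trans ?_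
    rw [hbz', (isUnit_C.2 (IsUnit.mk0 _ hb0)).mul_left_dvd]
    exact hr
  have hu := h (hwz p hzp) (hwz q hzq)
  have h1 : z.natDegree = 0 := by
    rw [← natDegree_C_mul (p := z) hb0, ← hbz', natDegree_map_eq_of_injective hinj,
      ← w.natDegree_primPart, natDegree_eq_zero_of_isUnit hu]
  exact hz.not_isUnit (isUnit_iff_degree_eq_zero.2
    ((degree_eq_iff_natDegree_eq hz.ne_zero).2 h1))

lemma natDegree_det_le {R ι : Type*} [CommRing R] [Fintype ι] [DecidableEq ι]
    (M : Matrix ι ι R[X]) (d : ℕ) (hM : ∀ i j, (M i j).natDegree ≤ d) :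
    M.det.natDegree ≤ Fintype.card ι * d := by
  rw [Matrix.det_apply]
  refine natDegree_sum_le_of_forall_le _ _ fun σ _ => ?_
  refine (natDegree_smul_le _ _).trans ((natDegree_prod_le _ _).trans ?_)
  simpa using Finset.sum_le_card_nsmul Finset.univ _ d fun i _ => hM (σ i) i

lemma natDegree_resultant_le {R : Type*} [CommRing R] (f g : R[X][X]) (m n d : ℕ)
    (hf : ∀ j, (f.coeff j).natDegree ≤ d) (hg : ∀ j, (g.coeff j).natDegree ≤ d) :
    (resultant f g m n).natDegree ≤ (m + n) * d := by
  have := natDegree_det_le (sylvester f g m n) d fun i j => by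
    induction j using Fin.addCases with
    | left j => simp only [sylvester, Matrix.of_apply, Fin.addCases_left]; split_ifs <;> simp [hg]
    | right j => simp only [sylvester, Matrix.of_apply, Fin.addCases_right]; split_ifs <;> simp [hf]
  simpa [resultant] using this

lemma exists_mul_add_mul_eq_C_of_isRelPrime {K : Type*} [Field K] {f g : K[X][X]} {s d : ℕ}
    (hfg : IsRelPrime f g) (hf0 : f.natDegree ≠ 0) (hfs : f.natDegree ≤ s) (hgs : g.natDegree ≤ s)
    (hf : ∀ j, (f.coeff j).natDegree ≤ d) (hg : ∀ j, (g.coeff j).natDegree ≤ d) :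
    ∃ r : K[X], r ≠ 0 ∧ r.natDegree ≤ 2 * s * d ∧ ∃ p q, f * p + g * q = C r := by
  obtain ⟨p, q, -, -, h⟩ := exists_mul_add_mul_eq_C_resultant f g le_rfl le_rfl (Or.inl hf0)
  refine ⟨resultant f g, fun h0 => ?_, ?_, p, q, h⟩
  · have hne : f ≠ 0 := by rintro rfl; simp at hf0
    have hinj := IsFractionRing.injective K[X] (RatFunc K)
    have hres := resultant_map_map f g f.natDegree g.natDegree (algebraMap K[X] (RatFunc K))
    have h1 : resultant (f.map (algebraMap K[X] (RatFunc K))) (g.map (algebraMap K[X] (RatFunc K)))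
        = 0 := by
      rw [natDegree_map_eq_of_injective hinj, natDegree_map_eq_of_injective hinj, hres, h0,
        map_zero]
    exact (resultant_eq_zero_iff.1 h1).2 (isCoprime_map_algebraMap_of_isRelPrime hne hfg)
  · refine (natDegree_resultant_le f g _ _ d hf hg).trans (Nat.mul_le_mul_right _ ?_)
    omega

/-- Double counting of the zeros of a family of polynomials of the same degree. -/
lemma card_mul_le_of_rootMultiplicity_le {K : Type*} [Field K] [IsAlgClosed K] {ι : Type*}
    (B : Finset ι) (p : ι → K[X]) (W : K[X]) (d s : ℕ)
    (hd : ∀ b ∈ B, d ≤ (p b).natDegree)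
    (hW : ∀ b ∈ B, ∀ x, (p b).eval x = 0 → (p b).rootMultiplicity x ≤ W.rootMultiplicity x)
    (hs : ∀ x, ∀ B' ⊆ B, (∀ b ∈ B', (p b).eval x = 0) → B'.card ≤ s) :
    B.card * d ≤ s * W.natDegree := by
  classical
  set Z := B.biUnion fun b => (p b).roots.toFinset
  have hsum : ∀ b ∈ B, d ≤ ∑ x ∈ Z, (p b).rootMultiplicity x := fun b hb => by
    refine (hd b hb).trans ?_
    rw [← splits_iff_card_roots.1 (IsAlgClosed.splits (p b)), ← Multiset.toFinset_sum_count_eq]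
    simp only [count_roots]
    exact Finset.sum_le_sum_of_subset
      (Finset.subset_biUnion_of_mem (fun b => (p b).roots.toFinset) hb)
  calc B.card * d ≤ ∑ b ∈ B, ∑ x ∈ Z, (p b).rootMultiplicity x := by
        simpa using Finset.card_nsmul_le_sum B _ d hsum
    _ = ∑ x ∈ Z, ∑ b ∈ B, (p b).rootMultiplicity x := Finset.sum_comm
    _ ≤ ∑ x ∈ Z, s * W.rootMultiplicity x := Finset.sum_le_sum fun x _ => ?_
    _ = s * ∑ x ∈ Z, W.rootMultiplicity x := by rw [Finset.mul_sum]
    _ ≤ s * W.natDegree := Nat.mul_le_mul_left _ ?_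
  · have hle : ∀ b ∈ B, (p b).rootMultiplicity x ≤
        if (p b).eval x = 0 then W.rootMultiplicity x else 0 := fun b hb => by
      split_ifs with h
      · exact hW b hb x h
      · exact (rootMultiplicity_eq_zero h).le
    refine (Finset.sum_le_sum hle).trans ?_
    rw [← Finset.sum_filter, Finset.sum_const, smul_eq_mul]
    exact Nat.mul_le_mul_right _ (hs x _ (Finset.filter_subset _ _) fun b hb =>
      (Finset.mem_filter.1 hb).2)
  · refine le_trans ?_ W.card_roots'
    simp only [← count_roots]
    rw [← Multiset.toFinset_sum_count_eq]
    exact Finset.sum_le_sum_of_ne_zero fun x _ hx =>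
      Multiset.mem_toFinset.2 (Multiset.count_ne_zero.1 hx)

end Polynomial

namespace Polynomial

lemma pow_rootMultiplicity_sub_one_dvd {K : Type*} [Field K] {f s g : K[X]} (hf : f ≠ 0)
    (h : s * derivative f = f * g) (x : K) :
    (X - C x) ^ (s.rootMultiplicity x - 1) ∣ g := by
  obtain rfl | hg := eq_or_ne g 0
  · exact dvd_zero _
  have hfg : f * g ≠ 0 := mul_ne_zero hf hg
  have hm := congrArg (rootMultiplicity x) h
  rw [rootMultiplicity_mul hfg, rootMultiplicity_mul (h ▸ hfg)] at hm
  have hle := rootMultiplicity_sub_one_le_derivative_rootMultiplicity_of_ne_zero f x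
    (right_ne_zero_of_mul (h ▸ hfg))
  rw [← le_rootMultiplicity_iff hg]
  omega

lemma IsPrimitive.map_evalRingHom_ne_zero {K : Type*} [Field K] {p : K[X][X]}
    (hp : p.IsPrimitive) (x : K) : p.map (evalRingHom x) ≠ 0 := fun h => by
  refine not_isUnit_X_sub_C x (hp _ ((C_dvd_iff_dvd_coeff _ _).2 fun i => ?_))
  rw [dvd_iff_isRoot]
  simpa using congrArg (fun q => q.coeff i) h

lemma IsPrimitive.natDegree_ne_zero_of_irreducible_of_dvd {R : Type*} [CommRing R] [IsDomain R]
    {p q : R[X]} (hp : p.IsPrimitive) (hq : Irreducible q) (hqp : q ∣ p) : q.natDegree ≠ 0 :=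
  fun h => by
    obtain ⟨r, rfl⟩ := natDegree_eq_zero.1 h
    exact hq.not_isUnit (isUnit_C.2 (hp r hqp))

namespace Bivariate

variable {K : Type*} [Field K] [CharZero K] {F S G c : K[X][X]}

/-- The denominator of the reduced logarithmic derivative controls the zeros of the leading
coefficient. -/
lemma eval_leadingCoeff_eq_zero (hF : F ≠ 0) (hS : c * S = F)
    (hG : c * G = innerDerivative F) {x : K} (hx : F.leadingCoeff.eval x = 0) :
    S.leadingCoeff.eval x = 0 := by
  obtain ⟨P, hP, hPF, hPx⟩ := exists_irreducible_dvd_map_eq_zero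
    ((evalRingHom x : K[X] →* K).comp leadingCoeffHom) hF hx
  replace hPx : P.leadingCoeff.eval x = 0 := hPx
  rcases dvd_or_innerDerivative_eq_zero hF hS hG hP hPF with ⟨Q, rfl⟩ | h
  · simp [hPx]
  · obtain ⟨k, hk⟩ := natDegree_eq_zero.1
      (natDegree_coeff_eq_zero_of_innerDerivative_eq_zero h P.natDegree)
    rw [coeff_natDegree] at hk
    rw [← hk, eval_C] at hPx
    exact (hP.ne_zero (leadingCoeff_eq_zero.1 (by rw [← hk, hPx, C_0]))).elim

/-- At a simple zero of the denominator of the reduced logarithmic derivative of `F`, the order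
of vanishing of `F` is the exponent of an irreducible factor of `F`. -/
lemma exists_irreducible_pow_dvd (hF : F ≠ 0) (hS : c * S = F)
    (hG : c * G = innerDerivative F) {b x : K} (hFb : F.eval (C b) ≠ 0)
    (hx : (S.eval (C b)).rootMultiplicity x = 1) :
    ∃ P, Irreducible P ∧ P ∣ F ∧ P ^ (F.eval (C b)).rootMultiplicity x ∣ F := by
  have hS0 : S ≠ 0 := right_ne_zero_of_mul (hS ▸ hF)
  have hSb : S.eval (C b) ≠ 0 := fun h => by simp [h] at hx
  let φ : K[X][X] →* K := (evalRingHom x : K[X] →* K).comp (evalRingHom (C b))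
  have hφ : ∀ p, φ p = (p.eval (C b)).eval x := fun p => rfl
  obtain ⟨P, hP, ⟨Q, rfl⟩, hPx⟩ := exists_irreducible_dvd_map_eq_zero φ hS0
    ((rootMultiplicity_pos hSb).1 (by omega))
  rw [eval_mul] at hSb
  rw [eval_mul, rootMultiplicity_mul hSb] at hx
  have hPpos := (rootMultiplicity_pos (left_ne_zero_of_mul hSb)).2 hPx
  have hQ : φ Q ≠ 0 := fun h => by
    have := (rootMultiplicity_pos (right_ne_zero_of_mul hSb)).2 h
    omega
  have hPF : P ∣ F := hS ▸ dvd_mul_of_dvd_right (dvd_mul_right _ _) _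
  refine ⟨P, hP, hPF, ?_⟩
  obtain ⟨W, hFW, hW⟩ :=
    (FiniteMultiplicity.of_not_isUnit hP.not_isUnit hF).exists_eq_pow_mul_and_not_dvd
  generalize multiplicity P F = e at hFW
  have hWF : W ∣ F := hFW ▸ dvd_mul_left _ _
  have hφW : φ W ≠ 0 := fun h => by
    obtain ⟨P', hP', hP'W, hP'x⟩ := exists_irreducible_dvd_map_eq_zero φ
      (by rintro rfl; exact hW (dvd_zero _)) h
    rcases dvd_or_innerDerivative_eq_zero hF hS hG hP' (hP'W.trans hWF) with h' | h'
    · rcases hP'.prime.dvd_or_dvd h' with h' | ⟨Q', rfl⟩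
      · exact hW ((hP'.associated_of_dvd hP h').symm.dvd.trans hP'W)
      · exact hQ (by rw [map_mul, hP'x, zero_mul])
    · have hdeg : (swap P').natDegree = 0 := by
        rw [← derivative_eq_zero, ← swap_innerDerivative, h', map_zero]
      obtain ⟨k, hk⟩ := natDegree_eq_zero.1 hdeg
      have hev : P'.eval (C b) = C (k.eval b) := by
        rw [eval_C_eq_map_swap, ← hk, map_C, coe_evalRingHom]
      rw [hφ, hev, eval_C] at hP'x
      obtain ⟨Q', hQ'⟩ := hP'W.trans hWF
      exact hFb (by rw [hQ', eval_mul, hev, hP'x, C_0, zero_mul])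
  have hPF' : (P.eval (C b)) ^ e * W.eval (C b) ≠ 0 := by
    rwa [hFW, eval_mul, eval_pow] at hFb
  have he : (F.eval (C b)).rootMultiplicity x = e := by
    have h1 : (P.eval (C b)).rootMultiplicity x = 1 := by omega
    have h2 : (W.eval (C b)).rootMultiplicity x = 0 := rootMultiplicity_eq_zero hφW
    classical
    rw [hFW, eval_mul, eval_pow, rootMultiplicity_mul hPF', h2, ← count_roots, roots_pow,
      Multiset.count_nsmul, count_roots, h1]
    simp
  rw [he, hFW]
  exact dvd_mul_right _ _

/-- If a primitive bivariate polynomial, not constant in the inner variable, has many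
specializations all of whose zeros away from those of the leading coefficient have order at least
`μ`, then it is divisible by the `μ`-th power of a polynomial of positive degree. -/
theorem exists_pow_dvd_of_many_powerful [IsAlgClosed K] (hF : F.IsPrimitive)
    (hF' : innerDerivative F ≠ 0) (μ : ℕ) (B : Finset K)
    (hB : 4 * F.natDegree ^ 2 + 2 * F.natDegree < B.card) (hB0 : ∀ b ∈ B, F.eval (C b) ≠ 0)
    (hBμ : ∀ b ∈ B, ∀ x, F.leadingCoeff.eval x ≠ 0 → (F.eval (C b)).eval x = 0 →
      μ ≤ (F.eval (C b)).rootMultiplicity x) :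
    ∃ P : K[X][X], P.natDegree ≠ 0 ∧ P ^ μ ∣ F := by
  classical
  by_contra! hno
  have hF0 := hF.ne_zero
  obtain ⟨S, G, c, hSG, hS, hG⟩ :=
    UniqueFactorizationMonoid.exists_reduced_factors F hF0 (innerDerivative F)
  have hc0 : c ≠ 0 := left_ne_zero_of_mul (hS ▸ hF0)
  have hS0 : S ≠ 0 := right_ne_zero_of_mul (hS ▸ hF0)
  have hG0 : G ≠ 0 := right_ne_zero_of_mul (hG ▸ hF')
  have hSprim : S.IsPrimitive := isPrimitive_of_dvd hF (hS ▸ dvd_mul_left _ _)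
  have hSF : S.natDegree ≤ F.natDegree := natDegree_le_of_dvd (hS ▸ dvd_mul_left _ _) hF0
  have hGS : innerDegree G < innerDegree S := by
    have h := innerDegree_innerDerivative_lt hF'
    rw [← hG, ← hS, innerDegree_mul hc0 hS0, innerDegree_mul hc0 hG0] at h
    omega
  have hGS' : G.natDegree ≤ S.natDegree := by
    have h := natDegree_innerDerivative_le F
    rw [← hG, ← hS, natDegree_mul hc0 hS0, natDegree_mul hc0 hG0] at h
    omega
  have hlog : S * innerDerivative F = F * G := by rw [← hG, ← hS]; ring
  set d := innerDegree S
  set s := S.natDegree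
  have hs0 : s ≠ 0 := fun h => by
    obtain ⟨r, hr⟩ := natDegree_eq_zero.1 h
    have hu : IsUnit S := hr ▸ isUnit_C.2 (hSprim r hr.dvd)
    have : d = 0 := natDegree_eq_zero_of_isUnit (hu.map (swap (R := K)))
    omega
  obtain ⟨R, hR0, hRdeg, p, q, hpq⟩ := exists_mul_add_mul_eq_C_of_isRelPrime hSG hs0 le_rfl hGS'
    (natDegree_coeff_le_innerDegree S)
    (fun j => (natDegree_coeff_le_innerDegree G j).trans hGS.le)
  have hL0 : S.leadingCoeff ≠ 0 := leadingCoeff_ne_zero.2 hS0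
  have hWdeg : (R ^ 2 * S.leadingCoeff).natDegree ≤ 2 * (2 * s * d) + d := by
    refine natDegree_mul_le.trans (add_le_add ?_ (natDegree_coeff_le_innerDegree S _))
    exact natDegree_pow_le.trans (Nat.mul_le_mul_left _ hRdeg)
  set ℓ := (swap S).leadingCoeff
  have hℓ0 : ℓ ≠ 0 := leadingCoeff_ne_zero.2 (swap_ne_zero hS0)
  have hBcard : B.card ≤ (B.filter fun b => ℓ.eval b ≠ 0).card + s := by
    rw [← Finset.card_filter_add_card_filter_not (s := B) (fun b => ℓ.eval b ≠ 0)]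
    refine Nat.add_le_add_left ?_ _
    refine le_trans ?_ (natDegree_coeff_swap_le S (swap S).natDegree)
    refine card_le_degree_of_subset_roots fun b hb => (mem_roots hℓ0).2 ?_
    simpa using (Finset.mem_filter.1 hb).2
  have key := card_mul_le_of_rootMultiplicity_le (B.filter fun b => ℓ.eval b ≠ 0)
    (fun b => S.eval (C b)) (R ^ 2 * S.leadingCoeff) d s
    (fun b hb => by
      rw [eval_C_eq_map_swap, natDegree_map_of_leadingCoeff_ne_zero _ (Finset.mem_filter.1 hb).2]
      rfl)
    (fun b hb x hx => ?_)
    (fun x B' _ hB' => ?_)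
  · have hle : (B.filter fun b => ℓ.eval b ≠ 0).card * d ≤ (4 * s ^ 2 + s) * d := by
      refine key.trans ((Nat.mul_le_mul_left s hWdeg).trans (le_of_eq ?_))
      ring
    have h1 := Nat.le_of_mul_le_mul_right hle (by omega)
    have h2 : s ^ 2 ≤ F.natDegree ^ 2 := Nat.pow_le_pow_left hSF 2
    omega
  · have hbB := (Finset.mem_filter.1 hb).1
    have hFb := hB0 b hbB
    have hSb : S.eval (C b) ≠ 0 := fun h => hFb (by rw [← hS, eval_mul, h, mul_zero])
    have hlogb : S.eval (C b) * derivative (F.eval (C b)) = F.eval (C b) * G.eval (C b) := by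
      rw [← eval_C_innerDerivative, ← eval_mul, hlog, eval_mul]
    have hRb : S.eval (C b) * p.eval (C b) + G.eval (C b) * q.eval (C b) = R := by
      rw [← eval_mul, ← eval_mul, ← eval_add, hpq, eval_C]
    have hRm : (S.eval (C b)).rootMultiplicity x - 1 ≤ R.rootMultiplicity x := by
      rw [le_rootMultiplicity_iff hR0, ← hRb]
      exact dvd_add (dvd_mul_of_dvd_left ((pow_dvd_pow _ (Nat.sub_le _ _)).trans
        (pow_rootMultiplicity_dvd _ _)) _)
        (dvd_mul_of_dvd_left (pow_rootMultiplicity_sub_one_dvd hFb hlogb x) _)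
    have hpos := (rootMultiplicity_pos hSb).2 hx
    have hm : (R ^ 2 * S.leadingCoeff).rootMultiplicity x =
        2 * R.rootMultiplicity x + S.leadingCoeff.rootMultiplicity x := by
      rw [sq, rootMultiplicity_mul (mul_ne_zero (mul_ne_zero hR0 hR0) hL0),
        rootMultiplicity_mul (mul_ne_zero hR0 hR0), two_mul]
    by_cases h1 : (S.eval (C b)).rootMultiplicity x = 1
    · by_cases hL : S.leadingCoeff.eval x = 0
      · have := (rootMultiplicity_pos hL0).2 hL
        omega
      · have hFL : F.leadingCoeff.eval x ≠ 0 := fun h =>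
          hL (eval_leadingCoeff_eq_zero hF0 hS hG h)
        have hFx : (F.eval (C b)).eval x = 0 := by
          rw [← hS, eval_mul, eval_mul, hx, mul_zero]
        obtain ⟨P, hP, hPF, hPm⟩ := exists_irreducible_pow_dvd hF0 hS hG hFb h1
        exact (hno P (hF.natDegree_ne_zero_of_irreducible_of_dvd hP hPF)
          ((pow_dvd_pow _ (hBμ b hbB x hFL hFx)).trans hPm)).elim
    · omega
  · refine le_trans (card_le_degree_of_subset_roots fun b hb => ?_)
      (natDegree_map_le (f := evalRingHom x) (p := S))
    refine (mem_roots (hSprim.map_evalRingHom_ne_zero x)).2 ?_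
    have h := hB' b hb
    have h2 : (S.map (evalRingHom x)).eval ((evalRingHom x) (C b)) =
      (evalRingHom x) (S.eval (C b)) := eval_map_apply ..
    simpa [h] using h2

end Bivariate

end Polynomial

/-- A monic polynomial over the fraction field of a UFD is, up to a scalar, a primitive polynomial
over the UFD. -/
lemma Polynomial.Monic.exists_isPrimitive_map_eq {R k : Type*} [CommRing R] [IsDomain R]
    [UniqueFactorizationMonoid R] [Field k] [Algebra R k] [IsFractionRing R k] {p : k[X]}
    (hp : p.Monic) :
    ∃ q : R[X], q.IsPrimitive ∧
      q.map (algebraMap R k) = C (algebraMap R k q.leadingCoeff) * p := by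
  obtain ⟨_⟩ : Nonempty (NormalizedGCDMonoid R) := inferInstance
  have hinj := IsFractionRing.injective R k
  obtain ⟨b, hb, hbp⟩ := IsLocalization.integerNormalization_spec (nonZeroDivisors R) p
  set w := IsLocalization.integerNormalization (nonZeroDivisors R) p
  have hw0 : w ≠ 0 := fun h => by
    rw [h, Polynomial.map_zero, ← algebraMap_smul k, eq_comm, smul_eq_zero] at hbp
    rcases hbp with h | h
    · exact nonZeroDivisors.ne_zero hb (hinj (by rw [h, map_zero]))
    · exact hp.ne_zero h
  have hc0 : algebraMap R k w.content ≠ 0 := fun h =>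
    hw0 (content_eq_zero_iff.1 (hinj (by rw [h, map_zero])))
  have hq : ∃ D, w.primPart.map (algebraMap R k) = C D * p := by
    refine ⟨(algebraMap R k w.content)⁻¹ * algebraMap R k b, ?_⟩
    rw [C_mul, mul_assoc, ← smul_eq_C_mul (p := p), algebraMap_smul, ← hbp]
    have hw := congrArg (Polynomial.map (algebraMap R k)) w.eq_C_content_mul_primPart
    rw [hw, Polynomial.map_mul, map_C, ← mul_assoc, ← C_mul, inv_mul_cancel₀ hc0, C_1, one_mul]
  obtain ⟨D, hD⟩ := hq
  refine ⟨w.primPart, w.isPrimitive_primPart, ?_⟩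
  have := congrArg Polynomial.leadingCoeff hD
  rw [leadingCoeff_map_of_injective hinj, leadingCoeff_mul, leadingCoeff_C, hp.leadingCoeff,
    mul_one] at this
  rw [hD, this]

/-- A monic polynomial of degree `n` over a field which is a scalar multiple of `q ^ n` for some
`q` of degree one is an `n`-th power of a monic polynomial. -/
lemma Polynomial.Monic.eq_X_add_C_pow {k : Type*} [Field k] {p q : k[X]} {n : ℕ} {r : k}
    (hp : p.Monic) (hq : q.natDegree = 1) (h : p = C r * q ^ n) :
    ∃ ν, p = (X + C ν) ^ n := by
  have hq1 : q.coeff 1 ≠ 0 := fun h0 => by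
    have : q.leadingCoeff = 0 := by rw [Polynomial.leadingCoeff, hq, h0]
    simp [leadingCoeff_eq_zero.1 this] at hq
  refine ⟨q.coeff 0 / q.coeff 1, ?_⟩
  have hqe : q = C (q.coeff 1) * (X + C (q.coeff 0 / q.coeff 1)) := by
    rw [mul_add, ← C_mul, mul_div_cancel₀ _ hq1]
    exact eq_X_add_C_of_natDegree_le_one hq.le
  rw [hqe, mul_pow, ← C_pow, ← mul_assoc, ← C_mul] at h
  have hlc := congrArg Polynomial.leadingCoeff h
  rw [hp.leadingCoeff, leadingCoeff_mul, leadingCoeff_C,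
    ((monic_X_add_C _).pow n).leadingCoeff, mul_one] at hlc
  rw [h, ← hlc, C_1, one_mul]

/-- Zeros of a numerator of a powerful rational function, away from the zeros of the
corresponding denominator, have high multiplicity. -/
lemma IsMuPowerful.le_rootMultiplicity {K : Type*} [Field K] {μ : ℕ} {f : RatFunc K}
    (hf : IsMuPowerful μ f) (hf0 : f ≠ 0) {p q : K[X]}
    (h : algebraMap K[X] (RatFunc K) p = algebraMap K[X] (RatFunc K) q * f) {x : K}
    (hq : q.eval x ≠ 0) (hp : p.eval x = 0) : μ ≤ p.rootMultiplicity x := by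
  have hd0 := f.denom_ne_zero
  have hpq : p * f.denom = q * f.num := by
    refine IsFractionRing.injective K[X] (RatFunc K) ?_
    rw [map_mul, map_mul, h]
    have : algebraMap K[X] (RatFunc K) f.denom ≠ 0 := RatFunc.algebraMap_ne_zero hd0
    nth_rw 1 [← RatFunc.num_div_denom f]
    field_simp
  have hq0 : q ≠ 0 := by rintro rfl; simp at hq
  have hn0 : f.num ≠ 0 := RatFunc.num_ne_zero hf0
  have hqn := mul_ne_zero hq0 hn0
  have hnx : f.num.eval x = 0 := by
    have := congrArg (eval x) hpq
    rw [eval_mul, eval_mul, hp, zero_mul] at this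
    exact (mul_eq_zero.1 this.symm).resolve_left hq
  have hdx : f.denom.eval x ≠ 0 := fun hdx => by
    obtain ⟨u, v, huv⟩ := f.isCoprime_num_denom
    simpa [hnx, hdx] using congrArg (eval x) huv
  have hm := congrArg (rootMultiplicity x) hpq
  rw [rootMultiplicity_mul (hpq ▸ hqn), rootMultiplicity_mul hqn,
    rootMultiplicity_eq_zero hdx, rootMultiplicity_eq_zero hq] at hm
  have := hf.1 x hnx
  omega

theorem buchi_main_theorem_genus_zero
    {K : Type*} [Field K] [IsAlgClosed K] [CharZero K]
    (n μ : ℕ) (hn : 2 ≤ n) (hμ : n ≤ μ)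
    (a : Fin n → RatFunc K)
    (ha : ∃ i, ∀ k : K, a i ≠ RatFunc.C k)
    (B : Finset K)
    (hB : 2 * n ^ 2 * (n + 1) * Nat.choose (3 * n - 1) n ≤ B.card)
    (hpow : ∀ b ∈ B,
      Polynomial.eval (RatFunc.C b)
          (X ^ n + ∑ i : Fin n, C (a i) * X ^ (i : ℕ) : Polynomial (RatFunc K)) ≠ 0 ∧
      IsMuPowerful μ (Polynomial.eval (RatFunc.C b)
          (X ^ n + ∑ i : Fin n, C (a i) * X ^ (i : ℕ) : Polynomial (RatFunc K)))) :
    μ = n ∧ ∃ ν : RatFunc K,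
      (X ^ n + ∑ i : Fin n, C (a i) * X ^ (i : ℕ) : Polynomial (RatFunc K))
        = (X + C ν) ^ n := by
  set F : Polynomial (RatFunc K) := X ^ n + ∑ i : Fin n, C (a i) * X ^ (i : ℕ) with hF
  have hFlt : (∑ i : Fin n, C (a i) * X ^ (i : ℕ) : Polynomial (RatFunc K)).degree < n :=
    degree_sum_fin_lt a
  have hFmonic : F.Monic := monic_X_pow_add hFlt
  have hFdeg : F.natDegree = n :=
    by
    have h : (X ^ n : Polynomial (RatFunc K)).degree = n := degree_X_pow n
    exact natDegree_eq_of_degree_eq_some ((degree_add_eq_left_of_degree_lt (h ▸ hFlt)).trans h)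
  have hFcoeff : ∀ i : Fin n, F.coeff i = a i := fun i => by
    simp [hF, coeff_X_pow, Fin.val_inj, i.2.ne]
  have hinj := IsFractionRing.injective K[X] (RatFunc K)
  obtain ⟨P, hPprim, hPF⟩ := hFmonic.exists_isPrimitive_map_eq (R := K[X])
  have hL0 : algebraMap K[X] (RatFunc K) P.leadingCoeff ≠ 0 :=
    RatFunc.algebraMap_ne_zero (leadingCoeff_ne_zero.2 hPprim.ne_zero)
  have hPdeg : P.natDegree = n := by
    rw [← natDegree_map_eq_of_injective hinj, hPF, natDegree_C_mul hL0, hFdeg]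
  have hPeval : ∀ b : K, algebraMap K[X] (RatFunc K) (P.eval (C b)) =
      algebraMap K[X] (RatFunc K) P.leadingCoeff * F.eval (RatFunc.C b) := fun b => by
    rw [← eval_map_apply, hPF, eval_mul, eval_C, RatFunc.algebraMap_C]
  have hP' : Bivariate.innerDerivative P ≠ 0 := fun h => by
    obtain ⟨i, hi⟩ := ha
    obtain ⟨k, hk⟩ := natDegree_eq_zero.1
      (Bivariate.natDegree_coeff_eq_zero_of_innerDerivative_eq_zero h i)
    obtain ⟨l, hl⟩ := natDegree_eq_zero.1
      (Bivariate.natDegree_coeff_eq_zero_of_innerDerivative_eq_zero h P.natDegree)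
    have hc := congrArg (fun q => q.coeff i) hPF
    simp only [coeff_map, coeff_C_mul, hFcoeff] at hc
    rw [leadingCoeff, ← hk, ← hl, RatFunc.algebraMap_C, RatFunc.algebraMap_C] at hc
    rw [leadingCoeff, ← hl, RatFunc.algebraMap_C] at hL0
    exact hi (k / l) (by rw [map_div₀, hc, mul_div_cancel_left₀ _ hL0])
  have hcard : 4 * P.natDegree ^ 2 + 2 * P.natDegree < B.card := by
    rw [hPdeg]
    refine lt_of_lt_of_le ?_ hB
    have hch : 1 ≤ Nat.choose (3 * n - 1) n := Nat.choose_pos (by omega)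
    calc 4 * n ^ 2 + 2 * n < 2 * n ^ 2 * (n + 1) * 1 := by nlinarith
      _ ≤ _ := Nat.mul_le_mul_left _ hch
  obtain ⟨Q, hQ0, hQ⟩ := Bivariate.exists_pow_dvd_of_many_powerful hPprim hP' μ B hcard
    (fun b hb h => (hpow b hb).1 (by
      have := hPeval b
      rw [h, map_zero] at this
      exact (mul_eq_zero.1 this.symm).resolve_left hL0))
    (fun b hb x hx hbx =>
      (hpow b hb).2.le_rootMultiplicity (hpow b hb).1 (hPeval b) hx hbx)
  have hQdeg := natDegree_le_of_dvd hQ hPprim.ne_zero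
  rw [natDegree_pow, hPdeg] at hQdeg
  have hμn : μ = n := le_antisymm
    ((Nat.le_mul_of_pos_right _ (Nat.pos_of_ne_zero hQ0)).trans hQdeg) hμ
  subst hμn
  have hQ1 : Q.natDegree = 1 := by
    have : Q.natDegree ≤ 1 := Nat.le_of_mul_le_mul_left (by simpa using hQdeg) (by omega)
    omega
  obtain ⟨H, hH⟩ := hQ
  have hHdeg : H.natDegree = 0 := by
    have hne : Q ^ μ * H ≠ 0 := hH ▸ hPprim.ne_zero
    have := hPdeg
    rw [hH, natDegree_mul (left_ne_zero_of_mul hne) (right_ne_zero_of_mul hne), natDegree_pow,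
      hQ1] at this
    omega
  obtain ⟨r, rfl⟩ := natDegree_eq_zero.1 hHdeg
  refine ⟨rfl, hFmonic.eq_X_add_C_pow (q := Q.map (algebraMap K[X] (RatFunc K)))
    (r := (algebraMap K[X] (RatFunc K) P.leadingCoeff)⁻¹ * algebraMap K[X] (RatFunc K) r)
    (by rw [natDegree_map_eq_of_injective hinj, hQ1]) ?_⟩
  have h1 : F = C (algebraMap K[X] (RatFunc K) P.leadingCoeff)⁻¹ *
      P.map (algebraMap K[X] (RatFunc K)) := by
    rw [hPF, ← mul_assoc, ← C_mul, inv_mul_cancel₀ hL0, C_1, one_mul]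
  have h2 : P.map (algebraMap K[X] (RatFunc K)) =
      Q.map (algebraMap K[X] (RatFunc K)) ^ μ * C (algebraMap K[X] (RatFunc K) r) := by
    rw [hH, Polynomial.map_mul, Polynomial.map_pow, map_C]
  rw [h1, h2, C_mul]
  ring
end

section
/- Let n ≥ 2 be an integer and set M = 2·n²·(n+1)·C(3n−1, n). Suppose q_1, q_2, …, q_M ∈ ℂ[x] are polynomials such that the sequence of n-th powers q_1^n, q_2^n, …, q_M^n has constant n-th differences equal to n!, i.e. for every k with 1 ≤ k ≤ M − n one has Σ_{j=0}^{n} (−1)^{n−j}·C(n, j)·q_{k+j}^n = n!. Then either every q_i is a constant polynomial, or there exists ν ∈ ℂ[x] such that q_k^n = (k + ν)^n for all k = 1, …, M. -/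
open Polynomial Finset

section Determinants

variable {R : Type*} [CommRing R]

/-- A determinant of polynomials of degree at most `d` has degree at most `d` times its size. -/
theorem Matrix.natDegree_det_le_card_mul {ι : Type*} [Fintype ι] [DecidableEq ι]
    (A : Matrix ι ι R[X]) {d : ℕ} (hA : ∀ i j, (A i j).natDegree ≤ d) :
    A.det.natDegree ≤ Fintype.card ι * d := by
  rw [Matrix.det_apply]
  refine natDegree_sum_le_of_forall_le _ _ fun σ _ => ?_
  refine (natDegree_smul_le _ _).trans ((natDegree_prod_le _ _).trans ?_)
  exact (Finset.sum_le_card_nsmul _ _ d fun i _ => hA _ _).trans (by simp)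

theorem Polynomial.natDegree_resultant_le_s2 {f g : R[X][X]} {d : ℕ}
    (hf : ∀ i, (f.coeff i).natDegree ≤ d) (hg : ∀ i, (g.coeff i).natDegree ≤ d) :
    (resultant f g).natDegree ≤ (f.natDegree + g.natDegree) * d := by
  refine (Matrix.natDegree_det_le_card_mul (d := d) _ fun i j => ?_).trans (by simp)
  induction j using Fin.addCases <;> simp only [sylvester, Matrix.of_apply, Fin.addCases_left,
    Fin.addCases_right] <;> split_ifs <;> simp [hf, hg]

end Determinants

namespace Polynomial

theorem Monic.resultant_ne_zero_of_irreducible {R : Type*} [CommRing R] [IsDomain R]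
    [IsIntegrallyClosed R] {f g : R[X]} (hf : f.Monic) (hirr : Irreducible f) (hfg : ¬ f ∣ g) :
    resultant f g ≠ 0 := by
  let φ := algebraMap R (FractionRing R)
  have hφ : Function.Injective φ := IsFractionRing.injective R (FractionRing R)
  have hirr' : Irreducible (f.map φ) :=
    (hf.irreducible_iff_irreducible_map_fraction_map (K := FractionRing R)).1 hirr
  have hcop : IsCoprime (f.map φ) (g.map φ) :=
    (hirr'.coprime_iff_not_dvd).2 fun h => hfg ((map_dvd_map φ hφ hf).1 h)
  have hres := resultant_ne_zero _ _ hcop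
  rw [natDegree_map_eq_of_injective hφ, natDegree_map_eq_of_injective hφ,
    resultant_map_map] at hres
  exact fun h => hres (by rw [h, map_zero])

theorem Monic.exists_multiset_irreducible_prod {R : Type*} [CommRing R] [IsDomain R]
    {f : R[X]} (hf : f.Monic) :
    ∃ s : Multiset R[X], (∀ g ∈ s, g.Monic ∧ Irreducible g) ∧ s.prod = f := by
  induction hd : f.natDegree using Nat.strong_induction_on generalizing f with
  | _ d ih =>
    by_cases h1 : f = 1
    · exact ⟨0, by simp, by simp [h1]⟩
    by_cases hirr : Irreducible f
    · exact ⟨{f}, by simp [hf, hirr], by simp⟩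
    rw [hf.irreducible_iff_natDegree] at hirr
    push Not at hirr
    obtain ⟨a, b, ha, hb, rfl, hda, hdb⟩ := hirr h1
    rw [ha.natDegree_mul hb] at hd
    obtain ⟨s, hs, rfl⟩ := ih a.natDegree (by omega) ha rfl
    obtain ⟨t, ht, rfl⟩ := ih b.natDegree (by omega) hb rfl
    refine ⟨s + t, fun g hg => ?_, Multiset.prod_add s t⟩
    exact (Multiset.mem_add.1 hg).elim (hs g) (ht g)

theorem card_le_natDegree_multiset_prod {R : Type*} [CommRing R] [IsDomain R]
    {s : Multiset R[X]} (hs : ∀ g ∈ s, g.Monic ∧ Irreducible g) :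
    s.card ≤ s.prod.natDegree := by
  rw [natDegree_multiset_prod_of_monic s fun g hg => (hs g hg).1]
  have := Multiset.card_nsmul_le_sum (s := s.map natDegree) (a := 1) fun d hd => by
    obtain ⟨g, hg, rfl⟩ := Multiset.mem_map.1 hd
    exact (hs g hg).1.natDegree_pos_of_not_isUnit (hs g hg).2.not_isUnit
  simpa using this

section CoeffDegree

variable {R : Type*} [CommRing R]

/-- The degree of a bivariate polynomial in the inner variable. -/
noncomputable def coeffDegree (p : R[X][X]) : ℕ :=
  p.support.sup fun i => (p.coeff i).natDegree

theorem natDegree_coeff_le_coeffDegree (p : R[X][X]) (i : ℕ) :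
    (p.coeff i).natDegree ≤ coeffDegree p := by
  by_cases hi : i ∈ p.support
  · exact Finset.le_sup (f := fun i => (p.coeff i).natDegree) hi
  · simp [notMem_support_iff.1 hi]

theorem coeffDegree_le {p : R[X][X]} {d : ℕ} (h : ∀ i, (p.coeff i).natDegree ≤ d) :
    coeffDegree p ≤ d :=
  Finset.sup_le fun i _ => h i

theorem coeffDegree_mul_le (p q : R[X][X]) :
    coeffDegree (p * q) ≤ coeffDegree p + coeffDegree q := by
  refine coeffDegree_le fun i => ?_
  rw [coeff_mul]
  refine natDegree_sum_le_of_forall_le _ _ fun x _ => natDegree_mul_le.trans ?_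
  exact add_le_add (natDegree_coeff_le_coeffDegree _ _) (natDegree_coeff_le_coeffDegree _ _)

theorem coeffDegree_multiset_prod_le {s : Multiset R[X][X]} {d : ℕ}
    (hs : ∀ p ∈ s, coeffDegree p ≤ d) : coeffDegree s.prod ≤ s.card * d := by
  induction s using Multiset.induction_on with
  | empty => exact coeffDegree_le fun i => by simp [coeff_one, apply_ite natDegree]
  | cons p s ih =>
    have h := coeffDegree_mul_le p s.prod
    have h₁ := hs p (Multiset.mem_cons_self p s)
    have h₂ := ih fun q hq => hs q (Multiset.mem_cons_of_mem hq)
    rw [Multiset.prod_cons, Multiset.card_cons, add_mul]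
    omega

theorem exists_coeff_coeff_coeffDegree_ne_zero {p : R[X][X]} (hp : 0 < coeffDegree p) :
    ∃ i, (p.coeff i).coeff (coeffDegree p) ≠ 0 := by
  have hne : p.support.Nonempty := by
    rw [Finset.nonempty_iff_ne_empty]
    intro h
    simp [coeffDegree, h] at hp
  obtain ⟨i, -, hi⟩ := Finset.exists_mem_eq_sup p.support hne fun i => (p.coeff i).natDegree
  have hi' : coeffDegree p = (p.coeff i).natDegree := hi
  refine ⟨i, ?_⟩
  rw [hi', coeff_natDegree, leadingCoeff_ne_zero]
  intro h0
  rw [hi', h0, natDegree_zero] at hp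
  exact hp.false

theorem card_filter_natDegree_eval_lt_le [IsDomain R] {p : R[X][X]} (hp : 0 < coeffDegree p)
    (S : Finset R) :
    #{k ∈ S | (p.eval (C k)).natDegree < coeffDegree p} ≤ p.natDegree := by
  let c : R[X] := ∑ i ∈ range (p.natDegree + 1), monomial i ((p.coeff i).coeff (coeffDegree p))
  have hcoeff : ∀ i, c.coeff i = (p.coeff i).coeff (coeffDegree p) := fun i => by
    simp only [c, finsetSum_coeff, coeff_monomial, Finset.sum_ite_eq', Finset.mem_range]
    split_ifs with h
    · rfl
    · rw [coeff_eq_zero_of_natDegree_lt (p := p) (by omega), coeff_zero]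
  have hc : c ≠ 0 := by
    obtain ⟨i, hi⟩ := exists_coeff_coeff_coeffDegree_ne_zero hp
    exact fun h => hi (by rw [← hcoeff, h, coeff_zero])
  have hdeg : c.natDegree ≤ p.natDegree := natDegree_le_iff_coeff_eq_zero.2 fun i hi => by
    rw [hcoeff, coeff_eq_zero_of_natDegree_lt hi, coeff_zero]
  have heval : ∀ k, c.eval k = (p.eval (C k)).coeff (coeffDegree p) := fun k => by
    simp only [c, eval_finsetSum, eval_monomial, eval_eq_sum_range (p := p), finsetSum_coeff,
      ← C_pow, coeff_mul_C]
  refine (Polynomial.card_le_degree_of_subset_roots (p := c) fun k hk => ?_).trans hdeg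
  rw [Finset.mem_val, Finset.mem_filter] at hk
  rw [mem_roots hc, IsRoot.def, heval]
  exact coeff_eq_zero_of_natDegree_lt hk.2

/-- The derivative of a bivariate polynomial with respect to the inner variable. -/
noncomputable def coeffDerivative (p : R[X][X]) : R[X][X] :=
  ∑ i ∈ range (p.natDegree + 1), monomial i (derivative (p.coeff i))

theorem coeff_coeffDerivative (p : R[X][X]) (i : ℕ) :
    (coeffDerivative p).coeff i = derivative (p.coeff i) := by
  simp only [coeffDerivative, finsetSum_coeff, coeff_monomial, Finset.sum_ite_eq',
    Finset.mem_range]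
  split_ifs with h
  · rfl
  · rw [coeff_eq_zero_of_natDegree_lt (by omega), derivative_zero]

theorem eval_C_coeffDerivative (p : R[X][X]) (k : R) :
    (coeffDerivative p).eval (C k) = derivative (p.eval (C k)) := by
  simp only [coeffDerivative, eval_finsetSum, eval_monomial, eval_eq_sum_range (p := p), ← C_pow,
    derivative_sum, derivative_mul, derivative_C, mul_zero, add_zero]

theorem Monic.not_dvd_coeffDerivative [IsDomain R] [CharZero R] {p : R[X][X]} (hp : p.Monic)
    (hd : 0 < coeffDegree p) : ¬ p ∣ coeffDerivative p := by
  obtain ⟨i, hi⟩ := exists_coeff_coeff_coeffDegree_ne_zero hd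
  have hne : coeffDerivative p ≠ 0 := fun h => by
    have h0 : derivative (p.coeff i) = 0 := by rw [← coeff_coeffDerivative, h, coeff_zero]
    rw [eq_C_of_natDegree_eq_zero (derivative_eq_zero.1 h0),
      coeff_C_of_ne_zero hd.ne'] at hi
    exact hi rfl
  refine hp.not_dvd_of_degree_lt hne ?_
  rw [degree_eq_natDegree hp.ne_zero, degree_lt_iff_coeff_zero]
  intro j hj
  rw [coeff_coeffDerivative]
  rcases hj.eq_or_lt with rfl | hj
  · simp [hp.coeff_natDegree]
  · rw [coeff_eq_zero_of_natDegree_lt hj, derivative_zero]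

end CoeffDegree

theorem le_rootMultiplicity_of_mul_add_mul_eq {R : Type*} [CommRing R] [IsDomain R]
    {p a b u v : R[X]} {x : R} {m : ℕ} (hp : p ≠ 0) (h : a * u + b * v = p) (ha : (X - C x) ^ m ∣ a)
    (hb : (X - C x) ^ m ∣ b) : m ≤ p.rootMultiplicity x :=
  (le_rootMultiplicity_iff hp).2 (h ▸ dvd_add (ha.mul_right u) (hb.mul_right v))

/-- If `g ^ e * h` is an `n`-th power with `0 < e < n`, then every zero of `g` is either multiple
or shared with `h`, so its multiplicity is controlled by eliminants of `g` with its derivative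
and with `h`. -/
theorem rootMultiplicity_le_two_mul_of_pow_eq {K : Type*} [Field K]
    {g h q r₁ r₂ u₁ v₁ u₂ v₂ : K[X]} {n e : ℕ} (he : 0 < e) (hen : e < n)
    (hq : g ^ e * h = q ^ n) (hg : g ≠ 0) (hr₁ : r₁ ≠ 0) (hr₂ : r₂ ≠ 0)
    (h₁ : g * u₁ + derivative g * v₁ = r₁) (h₂ : g * u₂ + h * v₂ = r₂) (x : K) :
    g.rootMultiplicity x ≤ 2 * (r₁ * r₂).rootMultiplicity x := by
  classical
  rw [rootMultiplicity_mul (mul_ne_zero hr₁ hr₂)]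
  have hdvd := pow_rootMultiplicity_dvd g x
  rcases Nat.lt_trichotomy (g.rootMultiplicity x) 1 with hb | hb | hb
  · omega
  · rw [hb] at hdvd
    suffices hh : (X - C x) ^ 1 ∣ h by
      have := le_rootMultiplicity_of_mul_add_mul_eq hr₂ h₂ hdvd hh
      omega
    rw [pow_one, dvd_iff_isRoot]
    by_contra hroot
    have hh : h ≠ 0 := by
      rintro rfl
      simp at hroot
    have hmul := congrArg (rootMultiplicity x) hq
    rw [rootMultiplicity_mul (mul_ne_zero (pow_ne_zero _ hg) hh), ← count_roots, ← count_roots,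
      ← count_roots, roots_pow, roots_pow, Multiset.count_nsmul, Multiset.count_nsmul, count_roots,
      count_roots, count_roots, hb, rootMultiplicity_eq_zero hroot] at hmul
    have : n ∣ e := ⟨_, by simpa using hmul⟩
    exact absurd (Nat.le_of_dvd he this) (by omega)
  · have hder : (X - C x) ^ (g.rootMultiplicity x - 1) ∣ derivative g :=
      pow_sub_one_dvd_derivative_of_pow_dvd hdvd
    have := le_rootMultiplicity_of_mul_add_mul_eq hr₁ h₁
      ((pow_dvd_pow _ (Nat.sub_le _ 1)).trans hdvd) hder
    omega

/-- Since a monic `G` has at most `deg G` zeros `k` at each fixed `x`, a pointwise bound on the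
zeros of the specializations `G(·, k)` by those of `r` gives a bound for the sum of their
degrees. -/
theorem Monic.sum_natDegree_eval_le {K : Type*} [Field K] [IsAlgClosed K] {G : K[X][X]}
    (hG : G.Monic) (S : Finset K) {r : K[X]} {c : ℕ}
    (h : ∀ k ∈ S, ∀ x, (G.eval (C k)).rootMultiplicity x ≤ c * r.rootMultiplicity x) :
    ∑ k ∈ S, (G.eval (C k)).natDegree ≤ G.natDegree * c * r.natDegree := by
  classical
  have hcard : ∀ p : K[X], p.natDegree = p.roots.card := fun p =>
    (IsAlgClosed.splits p).natDegree_eq_card_roots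
  have hle : ∑ k ∈ S, (G.eval (C k)).roots ≤ (G.natDegree * c) • r.roots := by
    rw [Multiset.le_iff_count]
    intro x
    simp only [Multiset.count_sum', Multiset.count_nsmul, count_roots]
    have hzeros : #{k ∈ S | (G.eval (C k)).rootMultiplicity x ≠ 0} ≤ G.natDegree := by
      have hGx : (G.map (evalRingHom x)).Monic := hG.map _
      rw [← hG.natDegree_map (evalRingHom x)]
      refine card_le_degree_of_subset_roots fun k hk => ?_
      rw [Finset.mem_val, Finset.mem_filter] at hk
      have heval : (G.map (evalRingHom x)).eval k = (G.eval (C k)).eval x := by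
        simpa [eval_map] using eval₂_at_apply (p := G) (evalRingHom x) (C k)
      rw [mem_roots hGx.ne_zero, IsRoot.def, heval]
      exact (rootMultiplicity_pos'.1 (Nat.pos_of_ne_zero hk.2)).2
    rw [← Finset.sum_filter_ne_zero]
    calc _ ≤ #{k ∈ S | (G.eval (C k)).rootMultiplicity x ≠ 0} • (c * r.rootMultiplicity x) :=
          Finset.sum_le_card_nsmul _ _ _ fun k hk => h k (Finset.mem_filter.1 hk).1 x
      _ ≤ _ := by
          rw [smul_eq_mul, mul_assoc]
          exact Nat.mul_le_mul_right _ hzeros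
  simpa [hcard] using Multiset.card_le_card hle

/-- A monic bivariate polynomial of positive degree in the inner variable is the product of a power
of an irreducible factor `G` of maximal inner degree and a cofactor prime to `G`. -/
theorem Monic.exists_eq_pow_mul_of_coeffDegree_pos {K : Type*} [Field K] {F : K[X][X]}
    (hF : F.Monic) (hd : 0 < coeffDegree F) :
    ∃ (G H : K[X][X]) (e : ℕ), G.Monic ∧ Irreducible G ∧ H.Monic ∧ 0 < e ∧ G ^ e * H = F ∧
      ¬ G ∣ H ∧ 0 < coeffDegree G ∧ coeffDegree H ≤ F.natDegree * coeffDegree G := by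
  classical
  obtain ⟨s, hs, rfl⟩ := hF.exists_multiset_irreducible_prod
  have hne : s.toFinset.Nonempty := by
    rw [Finset.nonempty_iff_ne_empty, Ne, Multiset.toFinset_eq_empty]
    rintro rfl
    exact hd.not_ge ((coeffDegree_multiset_prod_le (d := 0) (by simp)).trans (by simp))
  obtain ⟨G, hGs, hmax⟩ := s.toFinset.exists_max_image coeffDegree hne
  simp only [Multiset.mem_toFinset] at hGs hmax
  obtain ⟨hG, hirr⟩ := hs G hGs
  let t := s.filter fun p => ¬ p = G
  have ht : ∀ p ∈ t, p ∈ s ∧ p ≠ G := fun p hp => Multiset.mem_filter.1 hp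
  refine ⟨G, t.prod, s.count G, hG, hirr, ?_, Multiset.count_pos.2 hGs, ?_, fun hdvd => ?_, ?_, ?_⟩
  · simpa using monic_multiset_prod_of_monic t id fun p hp => (hs p (ht p hp).1).1
  · rw [← Multiset.prod_replicate, ← Multiset.filter_eq', ← Multiset.prod_add,
      Multiset.filter_add_not]
  · obtain ⟨p, hp, hGp⟩ := Prime.exists_mem_multiset_dvd hirr.prime hdvd
    obtain ⟨hps, hpG⟩ := ht p hp
    exact hpG (eq_of_monic_of_associated hG (hs p hps).1
      (hirr.associated_of_dvd (hs p hps).2 hGp)).symm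
  · by_contra! h0
    have := coeffDegree_multiset_prod_le (s := s) (d := 0) fun p hp => (hmax p hp).trans h0
    omega
  · refine (coeffDegree_multiset_prod_le fun p hp => hmax p (ht p hp).1).trans ?_
    exact Nat.mul_le_mul_right _ ((Multiset.card_le_card (Multiset.filter_le _ s)).trans
      (card_le_natDegree_multiset_prod hs))

/-- A monic bivariate polynomial of degree `n` that specializes to `n`-th powers at sufficiently
many constants is constant in the inner variable or the `n`-th power of a linear polynomial. -/
theorem Monic.coeffDegree_eq_zero_or_eq_pow {K : Type*} [Field K] [IsAlgClosed K] [CharZero K]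
    {F : K[X][X]} (hF : F.Monic) {n : ℕ} (hdeg : F.natDegree = n) (S : Finset K)
    (hS : 2 * n ^ 3 + 4 * n ^ 2 + n < #S) (hpow : ∀ k ∈ S, ∃ q : K[X], F.eval (C k) = q ^ n) :
    coeffDegree F = 0 ∨ ∃ ν : K[X], F = (X + C ν) ^ n := by
  rw [or_iff_not_imp_left, ← Ne, ← Nat.pos_iff_ne_zero]
  intro hd
  obtain ⟨G, H, e, hG, hirr, hH, he, rfl, hGH, hGd, hHd⟩ :=
    hF.exists_eq_pow_mul_of_coeffDegree_pos hd
  have hGpos : 0 < G.natDegree := hG.natDegree_pos_of_not_isUnit hirr.not_isUnit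
  rw [hdeg] at hHd
  rw [(hG.pow e).natDegree_mul hH, hG.natDegree_pow] at hdeg
  have heG : e ≤ e * G.natDegree := Nat.le_mul_of_pos_right e hGpos
  have hGe : G.natDegree ≤ e * G.natDegree := Nat.le_mul_of_pos_left _ he
  rcases (show e ≤ n by omega).eq_or_lt with rfl | hen
  · have hH1 : H = 1 := eq_one_of_monic_natDegree_zero hH (by omega)
    have hG1 : G.natDegree = 1 := Nat.eq_of_mul_eq_mul_left he (by omega)
    exact ⟨G.coeff 0, by rw [hH1, mul_one, ← hG.eq_X_add_C hG1]⟩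
  exfalso
  set d := coeffDegree G with hdG
  have hr₁ := hG.resultant_ne_zero_of_irreducible hirr (hG.not_dvd_coeffDerivative hGd)
  have hr₂ := hG.resultant_ne_zero_of_irreducible hirr hGH
  obtain ⟨u₁, v₁, -, -, h₁⟩ := exists_mul_add_mul_eq_C_resultant G (coeffDerivative G)
    le_rfl le_rfl (Or.inl hGpos.ne')
  obtain ⟨u₂, v₂, -, -, h₂⟩ := exists_mul_add_mul_eq_C_resultant G H
    le_rfl le_rfl (Or.inl hGpos.ne')
  set r₁ := resultant G (coeffDerivative G)
  set r₂ := resultant G H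
  have hr₁d : r₁.natDegree ≤ 2 * n * d := by
    refine (natDegree_resultant_le_s2 (natDegree_coeff_le_coeffDegree G) fun i => ?_).trans
      (Nat.mul_le_mul_right d ?_)
    · rw [coeff_coeffDerivative]
      exact (natDegree_derivative_le _).trans
        ((Nat.sub_le _ 1).trans (natDegree_coeff_le_coeffDegree G i))
    · have : (coeffDerivative G).natDegree ≤ G.natDegree :=
        natDegree_le_iff_coeff_eq_zero.2 fun i hi => by
          rw [coeff_coeffDerivative, coeff_eq_zero_of_natDegree_lt hi, derivative_zero]
      omega
  have hr₂d : r₂.natDegree ≤ n * (n * d) := by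
    refine (natDegree_resultant_le_s2 (fun i => ?_) fun i =>
      (natDegree_coeff_le_coeffDegree H i).trans hHd).trans
      (Nat.mul_le_mul_right (n * d) (by omega))
    exact (natDegree_coeff_le_coeffDegree G i).trans (Nat.le_mul_of_pos_left d (by omega))
  let S' := {k ∈ S | ¬ (G.eval (C k)).natDegree < d}
  have hS' : #S ≤ n + #S' := by
    have h := card_filter_natDegree_eval_lt_le hGd S
    rw [← hdG] at h
    have h' := S.card_filter_add_card_filter_not fun k => (G.eval (C k)).natDegree < d
    change _ + #S' = _ at h'
    omega
  have hupper := hG.sum_natDegree_eval_le S' (r := r₁ * r₂) (c := 2) fun k hk x => by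
    obtain ⟨hkS, hkd⟩ := Finset.mem_filter.1 hk
    obtain ⟨q, hq⟩ := hpow k hkS
    have h₁' := congrArg (eval (C k)) h₁
    have h₂' := congrArg (eval (C k)) h₂
    simp only [eval_add, eval_mul, eval_pow, eval_C, eval_C_coeffDerivative] at hq h₁' h₂'
    refine rootMultiplicity_le_two_mul_of_pow_eq he hen hq ?_ hr₁ hr₂ h₁' h₂' x
    intro h0
    rw [h0, natDegree_zero] at hkd
    exact hkd hGd
  have hlower : #S' * d ≤ ∑ k ∈ S', (G.eval (C k)).natDegree :=
    Finset.card_nsmul_le_sum _ _ d fun k hk => not_lt.1 (Finset.mem_filter.1 hk).2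
  have hbound : #S' * d ≤ (2 * n ^ 3 + 4 * n ^ 2) * d := by
    refine (hlower.trans hupper).trans ?_
    rw [Polynomial.natDegree_mul hr₁ hr₂]
    calc G.natDegree * 2 * (r₁.natDegree + r₂.natDegree)
        ≤ n * 2 * (2 * n * d + n * (n * d)) := by gcongr; omega
      _ = _ := by ring
  have := Nat.le_of_mul_le_mul_right hbound hGd
  omega

/-- A sequence whose `n`-th differences on `[1, M]` all equal `n!` is interpolated there by a monic
polynomial of degree `n`. -/
theorem exists_monic_eval_eq_of_fwdDiff_eq_factorial {K : Type*} [Field K] [CharZero K]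
    {n M : ℕ} (u : ℕ → K[X])
    (hu : ∀ k, 1 ≤ k → k ≤ M - n →
      ∑ j ∈ range (n + 1), (-1 : K[X]) ^ (n - j) * (n.choose j : K[X]) * u (k + j)
        = (n.factorial : K[X])) :
    ∃ F : K[X][X], F.Monic ∧ F.natDegree = n ∧ ∀ k, 1 ≤ k → k ≤ M → F.eval (k : K[X]) = u k := by
  let v : ℕ → K := fun i => (i : K)
  have hv : Set.InjOn v (Icc 1 n : Finset ℕ) := Nat.cast_injective.injOn
  let P : K[X][X] := ∑ i ∈ Icc 1 n, C (u i - (i : K[X]) ^ n) *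
    (Lagrange.basis (Icc 1 n) v i).map C
  have hP : P.degree < n := by
    refine (degree_sum_le _ _).trans_lt
      ((Finset.sup_lt_iff (WithBot.bot_lt_coe n)).2 fun i hi => ?_)
    rw [C_mul']
    refine (degree_smul_le _ _).trans_lt ?_
    rw [degree_map_eq_of_injective C_injective, Lagrange.degree_basis hv hi]
    have hlt : #(Icc 1 n) - 1 < n := by
      have := Finset.mem_Icc.1 hi
      rw [Nat.card_Icc]
      omega
    exact WithBot.coe_lt_coe.2 hlt
  have hnode : ∀ k ∈ Icc 1 n, P.eval (k : K[X]) = u k - (k : K[X]) ^ n := fun k hk => by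
    have hbasis : ∀ i, ((Lagrange.basis (Icc 1 n) v i).map C).eval (k : K[X]) =
        C ((Lagrange.basis (Icc 1 n) v i).eval (v k)) := fun i => by
      rw [← map_natCast (C : K →+* K[X]) k, eval_map, eval₂_at_apply]
    simp only [P, eval_finsetSum, eval_mul, eval_C, hbasis]
    rw [Finset.sum_eq_single k, Lagrange.eval_basis_self hv hk, C_1, mul_one]
    · intro i _ hik
      rw [Lagrange.eval_basis_of_ne hik hk, C_0, mul_zero]
    · exact fun h => absurd hk h
  have hmonic : (X ^ n + P).Monic := monic_X_pow_add hP
  have hnat : (X ^ n + P).natDegree = n := natDegree_eq_of_degree_eq_some (by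
    rw [degree_add_eq_left_of_degree_lt (by simpa using hP), degree_X_pow])
  refine ⟨X ^ n + P, hmonic, hnat, fun k => ?_⟩
  have hF : ∀ k : ℕ, ∑ j ∈ range (n + 1), (-1 : K[X]) ^ (n - j) * (n.choose j : K[X]) *
      (X ^ n + P).eval ((k + j : ℕ) : K[X]) = (n.factorial : K[X]) := fun k => by
    have h := congrFun (fwdDiff_iter_degree_eq_factorial (X ^ n + P)) (k : K[X])
    rw [fwdDiff_iter_eq_sum_shift, hnat, hmonic.leadingCoeff] at h
    simpa [zsmul_eq_mul, mul_add] using h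
  induction k using Nat.strong_induction_on with
  | _ k ih =>
    intro hk hkM
    by_cases hkn : k ≤ n
    · rw [eval_add, hnode k (Finset.mem_Icc.2 ⟨hk, hkn⟩)]
      simp
    · obtain ⟨l, rfl⟩ := Nat.exists_eq_add_of_le' (le_of_not_ge hkn)
      have h := (hF l).trans (hu l (by omega) (by omega)).symm
      rw [Finset.sum_range_succ, Finset.sum_range_succ,
        Finset.sum_congr rfl fun j hj => by
          have := Finset.mem_range.1 hj
          rw [ih (l + j) (by omega) (by omega) (by omega)]] at h
      simpa using h

end Polynomial

theorem buchi_nth_power_problem_complex_polynomials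
    (n : ℕ) (hn : 2 ≤ n)
    (q : ℕ → Polynomial ℂ)
    (hdiff : ∀ k : ℕ, 1 ≤ k → k ≤ 2 * n ^ 2 * (n + 1) * Nat.choose (3 * n - 1) n - n →
      ∑ j ∈ Finset.range (n + 1),
        (-1 : Polynomial ℂ) ^ (n - j) * (n.choose j : Polynomial ℂ) * (q (k + j)) ^ n
        = (n.factorial : Polynomial ℂ)) :
    (∀ k : ℕ, 1 ≤ k → k ≤ 2 * n ^ 2 * (n + 1) * Nat.choose (3 * n - 1) n →
        ∃ c : ℂ, q k = C c) ∨
    ∃ ν : Polynomial ℂ, ∀ k : ℕ, 1 ≤ k → k ≤ 2 * n ^ 2 * (n + 1) * Nat.choose (3 * n - 1) n →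
        (q k) ^ n = ((k : Polynomial ℂ) + ν) ^ n := by
  have hM : 2 * n ^ 3 + 4 * n ^ 2 + n < 2 * n ^ 2 * (n + 1) * Nat.choose (3 * n - 1) n := by
    have hchoose : 3 ≤ Nat.choose (3 * n - 1) n :=
      calc 3 ≤ n + 1 := by omega
        _ = Nat.choose (n + 1) n := (Nat.choose_succ_self_right n).symm
        _ ≤ Nat.choose (3 * n - 1) n := Nat.choose_le_choose n (by omega)
    calc 2 * n ^ 3 + 4 * n ^ 2 + n < 2 * n ^ 2 * (n + 1) * 3 := by nlinarith [Nat.zero_le (n ^ 3)]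
      _ ≤ _ := Nat.mul_le_mul_left _ hchoose
  generalize 2 * n ^ 2 * (n + 1) * Nat.choose (3 * n - 1) n = M at *
  obtain ⟨F, hF, hdeg, heval⟩ :=
    exists_monic_eval_eq_of_fwdDiff_eq_factorial (fun k => q k ^ n) hdiff
  have hcard : #((Icc 1 M).image (Nat.cast : ℕ → ℂ)) = M := by
    rw [Finset.card_image_of_injective _ Nat.cast_injective, Nat.card_Icc, Nat.add_sub_cancel]
  rcases hF.coeffDegree_eq_zero_or_eq_pow hdeg ((Icc 1 M).image Nat.cast) (hM.trans_eq hcard.symm)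
    fun c hc => by
      obtain ⟨k, hk, rfl⟩ := Finset.mem_image.1 hc
      obtain ⟨hk₁, hkM⟩ := Finset.mem_Icc.1 hk
      exact ⟨q k, by rw [map_natCast, heval k hk₁ hkM]⟩ with h0 | ⟨ν, rfl⟩
  · refine Or.inl fun k hk₁ hkM => ⟨(q k).coeff 0, eq_C_of_natDegree_eq_zero ?_⟩
    have hconst : (F.eval (C (k : ℂ))).natDegree = 0 := by
      rw [eval_eq_sum_range, ← Nat.le_zero]
      refine natDegree_sum_le_of_forall_le _ _ fun i _ => ?_
      rw [← C_pow]
      exact (natDegree_mul_C_le _ _).trans ((natDegree_coeff_le_coeffDegree F i).trans h0.le)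
    rw [map_natCast, heval k hk₁ hkM, natDegree_pow] at hconst
    exact (Nat.mul_eq_zero.1 hconst).resolve_left (by omega)
  · exact Or.inr ⟨ν, fun k hk₁ hkM => by simp [← heval k hk₁ hkM]⟩
end
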